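/- With n_{vw} := 4(e_{vw} − b) and c := 1 − 4/m as above and ℓ_v^{1/2}, ℓ_w^{1/2} the corner Lagrange functions with μ = 1/2, the function ℓ_{vw}(x) := max{0, n_{vw}ᵀx − c} − ℓ_v^{1/2}(x) − ℓ_w^{1/2}(x) satisfies ℓ_{vw}(e_{vw}) = 1, ℓ_{vw}(u) = 0 for every vertex u of S_v^{1/2} ∪ S_w^{1/2} other than e_{vw}, and ℓ_{vw}(x) = 0 for all x in corners S_u^{1/2} with u ∉ {v,w}. -/

import Mathlib

/-- Pairing a corner normal with a point: `∑_{t ≠ s} (x s - x t) = m x_s - ∑ x`. -/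
lemma sum_cornerNormal_mul {V : Type*} [Fintype V] [DecidableEq V] (a : ℝ) (s : V) (x : V → ℝ) :
    ∑ u, (a • ∑ t ∈ Finset.univ.erase s,
      ((Pi.single s 1 : V → ℝ) - Pi.single t 1) : V → ℝ) u * x u =
      a * (Fintype.card V * x s - ∑ u, x u) := by
  have h : ∑ t ∈ Finset.univ.erase s, ((Pi.single s 1 : V → ℝ) - Pi.single t 1) =
      ∑ t, ((Pi.single s 1 : V → ℝ) - Pi.single t 1) :=
    Finset.sum_erase _ (sub_self _)
  rw [h]
  simp only [Pi.smul_apply, Finset.sum_apply, Pi.sub_apply, smul_eq_mul, Finset.sum_sub_distrib,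
    Finset.sum_const, Finset.card_univ, nsmul_eq_mul, Finset.sum_pi_single, Finset.mem_univ,
    if_true, mul_assoc, sub_mul, one_mul, ← Finset.mul_sum]
  simp [Pi.single_apply]

/-- Pairing an edge normal `4 (e_{vw} - b)` with a point. -/
lemma sum_edgeNormal_mul {V : Type*} [Fintype V] [DecidableEq V] (a : ℝ) (v w : V) (x : V → ℝ) :
    ∑ u, ((4 : ℝ) • ((1/2 : ℝ) • ((Pi.single v 1 : V → ℝ) + Pi.single w 1) -
      a • ∑ t, (Pi.single t 1 : V → ℝ)) : V → ℝ) u * x u =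
      2 * (x v + x w) - 4 * a * ∑ u, x u := by
  simp only [Pi.smul_apply, Finset.sum_apply, Pi.sub_apply, Pi.add_apply, smul_eq_mul,
    Finset.sum_pi_single, Finset.mem_univ, if_true, mul_assoc, sub_mul, add_mul, one_mul,
    ← Finset.mul_sum, Finset.sum_sub_distrib, Finset.sum_add_distrib]
  simp [Pi.single_apply]
  ring

/-- In a corner at `u ∉ {v, w}`, the coordinates at `v` and `w` are nonnegative with sum at most
`1/2`. -/
lemma convexHull_corner_subset {V : Type*} [Fintype V] [DecidableEq V] {u v w : V}
    (hvw : v ≠ w) (huv : u ≠ v) (huw : u ≠ w) :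
    convexHull ℝ (({Pi.single u 1} : Set (V → ℝ)) ∪
      {p | ∃ t, t ≠ u ∧ p = (1/2 : ℝ) • ((Pi.single u 1 : V → ℝ) + Pi.single t 1)}) ⊆
      {x | ∑ t, x t = 1 ∧ 0 ≤ x v ∧ 0 ≤ x w ∧ x v + x w ≤ 1/2} := by
  refine convexHull_min ?_ ?_
  · rintro x (rfl | ⟨t, -, rfl⟩)
    · simp [huv.symm, huw.symm]
    · refine ⟨?_, ?_⟩
      · simp [← Finset.mul_sum, Finset.sum_add_distrib]
        norm_num
      · by_cases htv : v = t
        · subst htv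
          simp [huv.symm, huw.symm, hvw.symm]
        · by_cases htw : w = t
          · subst htw
            simp [huv.symm, huw.symm, hvw]
          · simp [huv.symm, huw.symm, htv, htw]
  · rintro x ⟨hx, hxv, hxw, hxs⟩ y ⟨hy, hyv, hyw, hys⟩ p q hp hq hpq
    refine ⟨?_, ?_, ?_, ?_⟩
    · simp [Finset.sum_add_distrib, ← Finset.mul_sum, hx, hy, hpq]
    · simp only [Pi.add_apply, Pi.smul_apply, smul_eq_mul]
      positivity
    · simp only [Pi.add_apply, Pi.smul_apply, smul_eq_mul]
      positivity
    · simp only [Pi.add_apply, Pi.smul_apply, smul_eq_mul]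
      nlinarith [mul_le_mul_of_nonneg_left hxs hp, mul_le_mul_of_nonneg_left hys hq]


/-- The edge-midpoint Lagrange function
`ℓ_{vw}(x) = max{0, n_{vw}ᵀx − c} − ℓ_v^{1/2}(x) − ℓ_w^{1/2}(x)`
equals 1 at `e_{vw}`, vanishes at every vertex of the corners `S_v^{1/2}` and
`S_w^{1/2}` other than `e_{vw}`, and vanishes on every corner `S_u^{1/2}` with
`u ∉ {v,w}`. -/
theorem stmt_8 {V : Type*} [Fintype V] [DecidableEq V]
    (hm : 4 ≤ Fintype.card V) (v w : V) (hvw : v ≠ w) :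
    let m : ℝ := Fintype.card V
    let e : V → (V → ℝ) := fun u => Pi.single u 1
    let mid : V → V → (V → ℝ) := fun s t => (1/2 : ℝ) • (e s + e t)
    let b : V → ℝ := (1 / m) • ∑ u, e u
    let nvw : V → ℝ := (4 : ℝ) • (mid v w - b)
    let c : ℝ := 1 - 4 / m
    let ncorner : V → (V → ℝ) := fun s => (2 / m) • ∑ u ∈ Finset.univ.erase s, (e s - e u)
    let dhalf : ℝ := (m - 2) / m
    let ℓhalf : V → (V → ℝ) → ℝ := fun s x => max 0 (∑ u, ncorner s u * x u - dhalf)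
    let ℓvw : (V → ℝ) → ℝ :=
      fun x => max 0 (∑ u, nvw u * x u - c) - ℓhalf v x - ℓhalf w x
    ℓvw (mid v w) = 1 ∧
    ℓvw (e v) = 0 ∧ ℓvw (e w) = 0 ∧
    (∀ u : V, u ≠ v → u ≠ w → ℓvw (mid v u) = 0 ∧ ℓvw (mid w u) = 0) ∧
    (∀ u : V, u ≠ v → u ≠ w →
      ∀ x ∈ convexHull ℝ (({e u} : Set (V → ℝ)) ∪
        {p | ∃ t, t ≠ u ∧ p = mid u t}), ℓvw x = 0) := by
  intro m e mid b nvw c ncorner dhalf ℓhalf ℓvw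
  have hm0 : m ≠ 0 := by
    have h : Fintype.card V ≠ 0 := by omega
    exact Nat.cast_ne_zero.mpr h
  have key : ∀ x : V → ℝ, ∑ t, x t = 1 → ℓvw x =
      max 0 (2 * (x v + x w) - 1) - max 0 (2 * x v - 1) - max 0 (2 * x w - 1) := by
    intro x hx
    have hhalf : ∀ s, ℓhalf s x = max 0 (2 * x s - 1) := by
      intro s
      have h : ∑ u, ncorner s u * x u = 2 / m * (m * x s - ∑ u, x u) :=
        sum_cornerNormal_mul (2 / m) s x
      change max 0 (∑ u, ncorner s u * x u - (m - 2) / m) = _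
      rw [h, hx]
      congr 1
      field_simp
      ring
    have h : ∑ u, nvw u * x u = 2 * (x v + x w) - 4 * (1 / m) * ∑ u, x u :=
      sum_edgeNormal_mul (1 / m) v w x
    change max 0 (∑ u, nvw u * x u - (1 - 4 / m)) - ℓhalf v x - ℓhalf w x = _
    rw [h, hx, hhalf, hhalf]
    congr 3
    ring
  have he : ∀ s, ∑ t, e s t = 1 := by
    intro s
    simp [e]
  have hmid : ∀ s t, ∑ r, mid s t r = 1 := by
    intro s t
    simp only [mid, Pi.smul_apply, Pi.add_apply, smul_eq_mul, ← Finset.mul_sum,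
      Finset.sum_add_distrib, he]
    norm_num
  refine ⟨?_, ?_, ?_, fun u huv huw => ⟨?_, ?_⟩, fun u huv huw x hx => ?_⟩
  · rw [key _ (hmid v w)]
    norm_num [mid, e, hvw, hvw.symm]
  · rw [key _ (he v)]
    norm_num [e, hvw, hvw.symm]
  · rw [key _ (he w)]
    norm_num [e, hvw, hvw.symm]
  · rw [key _ (hmid v u)]
    norm_num [mid, e, hvw, hvw.symm, huv.symm, huw.symm]
  · rw [key _ (hmid w u)]
    norm_num [mid, e, hvw, hvw.symm, huv.symm, huw.symm]
  · obtain ⟨hs, hv, hw, hle⟩ := convexHull_corner_subset hvw huv huw hx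
    rw [key x hs, max_eq_left (by linarith), max_eq_left (by linarith),
      max_eq_left (by linarith)]
    norm_num
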